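/- Let h_1,…,h_n ∈ H and let h = min_{i} h_i be their pointwise minimum. If h is dually subadditive and h_j = h for some j ∈ {1,…,n}, then for every X ∈ L^∞: ⊟_{i=1}^n ρ_{h_i}(X) = ⊞_{i=1}^n ρ_{h_i}(X) = ρ_h(X) ≥ □_{i=1}^n ρ_{h_i}(X). -/

import Mathlib

open MeasureTheory ProbabilityTheory Set

noncomputable section

variable {Ω : Type*} [MeasurableSpace Ω]

/-- An atomless measure: every set of positive measure has a measurable subset of
strictly smaller positive measure. -/
def Atomless (P : Measure Ω) : Prop :=
  ∀ A : Set Ω, MeasurableSet A → 0 < P A →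
    ∃ B, B ⊆ A ∧ MeasurableSet B ∧ 0 < P B ∧ P B < P A

/-- Membership in the class `H` of distortion functions: increasing on `[0,1]`,
`h 0 = 0` and `h 1 = 1`. -/
def MemH (h : ℝ → ℝ) : Prop :=
  MonotoneOn h (Icc 0 1) ∧ h 0 = 0 ∧ h 1 = 1

/-- Two random variables are counter-monotonic. -/
def CounterMonotone (P : Measure Ω) (X Y : Ω → ℝ) : Prop :=
  ∀ᵐ p ∂(P.prod P), (X p.1 - X p.2) * (Y p.1 - Y p.2) ≤ 0

/-- Two random variables are comonotonic. -/
def Comonotone (P : Measure Ω) (X Y : Ω → ℝ) : Prop :=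
  ∀ᵐ p ∂(P.prod P), 0 ≤ (X p.1 - X p.2) * (Y p.1 - Y p.2)

/-- A random vector is pairwise counter-monotonic. -/
def PairwiseCtr (P : Measure Ω) {n : ℕ} (Xs : Fin n → Ω → ℝ) : Prop :=
  ∀ i j, i ≠ j → CounterMonotone P (Xs i) (Xs j)

/-- A random vector is (pairwise) comonotonic. -/
def PairwiseCom (P : Measure Ω) {n : ℕ} (Xs : Fin n → Ω → ℝ) : Prop :=
  ∀ i j, i ≠ j → Comonotone P (Xs i) (Xs j)

/-- The distortion risk measure `ρ_h(X) = ∫_0^∞ h(P(X ≥ x)) dx + ∫_{-∞}^0 (h(P(X ≥ x)) − 1) dx`. -/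
def distortion (P : Measure Ω) (h : ℝ → ℝ) (X : Ω → ℝ) : ℝ :=
  (∫ x in Ioi (0:ℝ), h ((P {ω | x ≤ X ω}).toReal)) +
    ∫ x in Iio (0:ℝ), (h ((P {ω | x ≤ X ω}).toReal) - 1)

/-- Bounded (essentially bounded, taking the everywhere-bounded representative)
measurable random variables. -/
def MemLinf (X : Ω → ℝ) : Prop :=
  Measurable X ∧ ∃ M : ℝ, ∀ ω, |X ω| ≤ M

/-- `Xs` is an allocation of `X` in `L^∞`. -/
def IsAlloc (P : Measure Ω) {n : ℕ} (X : Ω → ℝ) (Xs : Fin n → Ω → ℝ) : Prop :=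
  (∀ i, MemLinf (Xs i)) ∧ (∀ᵐ ω ∂P, ∑ i, Xs i ω = X ω)

/-- The (unconstrained) inf-convolution `□_{i=1}^n ρ_{h_i}(X)`, valued in `EReal`. -/
def infConv (P : Measure Ω) {n : ℕ} (h : Fin n → ℝ → ℝ) (X : Ω → ℝ) : EReal :=
  sInf {y : EReal | ∃ Xs : Fin n → Ω → ℝ, IsAlloc P X Xs ∧
    y = ((∑ i, distortion P (h i) (Xs i) : ℝ) : EReal)}

/-- The comonotonic inf-convolution `⊞_{i=1}^n ρ_{h_i}(X)`. -/
def comInfConv (P : Measure Ω) {n : ℕ} (h : Fin n → ℝ → ℝ) (X : Ω → ℝ) : EReal :=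
  sInf {y : EReal | ∃ Xs : Fin n → Ω → ℝ, IsAlloc P X Xs ∧ PairwiseCom P Xs ∧
    y = ((∑ i, distortion P (h i) (Xs i) : ℝ) : EReal)}

/-- The counter-monotonic inf-convolution `⊟_{i=1}^n ρ_{h_i}(X)`. -/
def ctrInfConv (P : Measure Ω) {n : ℕ} (h : Fin n → ℝ → ℝ) (X : Ω → ℝ) : EReal :=
  sInf {y : EReal | ∃ Xs : Fin n → Ω → ℝ, IsAlloc P X Xs ∧ PairwiseCtr P Xs ∧
    y = ((∑ i, distortion P (h i) (Xs i) : ℝ) : EReal)}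

/-- `h` is dually subadditive: `h` is subadditive and its dual `h̃(t) = 1 − h(1−t)`
is superadditive (on `[0,1]`). -/
def DuallySubadditive (h : ℝ → ℝ) : Prop :=
  (∀ x y : ℝ, 0 ≤ x → 0 ≤ y → x + y ≤ 1 → h (x + y) ≤ h x + h y) ∧
  (∀ x y : ℝ, 0 ≤ x → 0 ≤ y → x + y ≤ 1 →
    (1 - h (1 - x)) + (1 - h (1 - y)) ≤ 1 - h (1 - (x + y)))

/-- The distorted survival function `t ↦ h(P(Z ≥ t))`. -/
def distSurvival (P : Measure Ω) (h : ℝ → ℝ) (Z : Ω → ℝ) (t : ℝ) : ℝ :=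
  h ((P {ω | t ≤ Z ω}).toReal)

/-- Everywhere bounded functions, with no measurability requirement. -/
def IsBdd (Z : Ω → ℝ) : Prop := ∃ M : ℝ, ∀ ω, |Z ω| ≤ M

section Basic

variable {P : Measure Ω} [IsProbabilityMeasure P] {h : ℝ → ℝ}

lemma toReal_mem_Icc (P : Measure Ω) [IsProbabilityMeasure P] (s : Set Ω) :
    (P s).toReal ∈ Icc (0:ℝ) 1 :=
  ⟨ENNReal.toReal_nonneg, by
    simpa using ENNReal.toReal_mono ENNReal.one_ne_top (prob_le_one (μ := P) (s := s))⟩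

lemma MemH.apply_measure_mono (hh : MemH h) {s t : Set Ω} (hst : s ⊆ t) :
    h (P s).toReal ≤ h (P t).toReal :=
  hh.1 (toReal_mem_Icc P s) (toReal_mem_Icc P t)
    (ENNReal.toReal_mono (measure_ne_top P t) (measure_mono hst))

lemma MemH.antitone_distSurvival (hh : MemH h) (Z : Ω → ℝ) :
    Antitone (distSurvival P h Z) := fun _ _ hst =>
  hh.apply_measure_mono fun _ hω => hst.trans hω

lemma MemH.distSurvival_intervalIntegrable (hh : MemH h) (Z : Ω → ℝ) (a b : ℝ) :
    IntervalIntegrable (distSurvival P h Z) volume a b :=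
  (hh.antitone_distSurvival Z).intervalIntegrable

lemma MemH.distSurvival_eq_one (hh : MemH h) {Z : Ω → ℝ} {t : ℝ} (ht : ∀ ω, t ≤ Z ω) :
    distSurvival P h Z t = 1 := by
  simp [distSurvival, ht, hh.2.2]

lemma MemH.distSurvival_eq_zero (hh : MemH h) {Z : Ω → ℝ} {t : ℝ} (ht : ∀ ω, Z ω < t) :
    distSurvival P h Z t = 0 := by
  have : {ω | t ≤ Z ω} = ∅ := by
    ext ω
    simpa using ht ω
  simp [distSurvival, this, hh.2.1]

/-- On bounded variables the distortion risk measure is an integral over a compact interval. -/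
lemma MemH.distortion_eq (hh : MemH h) {Z : Ω → ℝ} {lo hi : ℝ} (hlo : lo ≤ 0) (hhi : 0 ≤ hi)
    (hZ : ∀ ω, Z ω ∈ Icc lo hi) :
    distortion P h Z = (∫ t in lo..hi, distSurvival P h Z t) + lo := by
  have hpos : ∫ t in Ioi (0:ℝ), distSurvival P h Z t = ∫ t in (0:ℝ)..hi, distSurvival P h Z t := by
    rw [intervalIntegral.integral_of_le hhi]
    refine setIntegral_eq_of_subset_of_forall_sdiff_eq_zero measurableSet_Ioi
      (fun t ht => ht.1) fun t ht => hh.distSurvival_eq_zero fun ω => ?_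
    have : hi < t := by
      by_contra! hc
      exact ht.2 ⟨ht.1, hc⟩
    exact (hZ ω).2.trans_lt this
  have hneg : ∫ t in Iio (0:ℝ), (distSurvival P h Z t - 1)
      = ∫ t in lo..(0:ℝ), (distSurvival P h Z t - 1) := by
    rw [intervalIntegral.integral_of_le hlo, ← integral_Iic_eq_integral_Iio]
    refine setIntegral_eq_of_subset_of_forall_sdiff_eq_zero measurableSet_Iic
      (fun t ht => ht.2) fun t ht => ?_
    have : t ≤ lo := by
      by_contra! hc
      exact ht.2 ⟨hc, ht.1⟩
    rw [hh.distSurvival_eq_one fun ω => this.trans (hZ ω).1, sub_self]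
  have hsplit := intervalIntegral.integral_add_adjacent_intervals
    (hh.distSurvival_intervalIntegrable (P := P) Z lo 0)
    (hh.distSurvival_intervalIntegrable (P := P) Z 0 hi)
  have hsub : ∫ t in lo..(0:ℝ), (distSurvival P h Z t - 1)
      = (∫ t in lo..(0:ℝ), distSurvival P h Z t) + lo := by
    rw [intervalIntegral.integral_sub (hh.distSurvival_intervalIntegrable Z lo 0)
      intervalIntegrable_const]
    simp
  change (∫ t in Ioi (0:ℝ), distSurvival P h Z t)
    + ∫ t in Iio (0:ℝ), (distSurvival P h Z t - 1) = _
  rw [hpos, hneg, hsub, ← hsplit]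
  ring

lemma distortion_congr_ae {Z Z' : Ω → ℝ} (hZ : Z =ᵐ[P] Z') :
    distortion P h Z = distortion P h Z' := by
  have (t : ℝ) : P {ω | t ≤ Z ω} = P {ω | t ≤ Z' ω} := by
    refine measure_congr ?_
    filter_upwards [hZ] with ω hω
    change (t ≤ Z ω) = (t ≤ Z' ω)
    rw [hω]
  simp only [distortion, this]

lemma MemH.distortion_const (hh : MemH h) (c : ℝ) : distortion P h (fun _ => c) = c := by
  rw [hh.distortion_eq (lo := min c 0) (hi := max c 0) (min_le_right _ _) (le_max_right _ _)
    fun _ => ⟨min_le_left _ _, le_max_left _ _⟩,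
    ← intervalIntegral.integral_add_adjacent_intervals (b := c)
      (hh.distSurvival_intervalIntegrable _ _ _) (hh.distSurvival_intervalIntegrable _ _ _)]
  have hone : ∫ t in (min c 0)..c, distSurvival P h (fun _ => c) t = ∫ _t in (min c 0)..c, 1 := by
    refine intervalIntegral.integral_congr fun t ht => ?_
    rw [uIcc_of_le (min_le_left _ _)] at ht
    exact hh.distSurvival_eq_one fun _ => ht.2
  have hzero : ∫ t in c..(max c 0), distSurvival P h (fun _ => c) t = 0 := by
    rw [intervalIntegral.integral_of_le (le_max_left _ _)]
    exact setIntegral_eq_zero_of_forall_eq_zero fun t ht => hh.distSurvival_eq_zero fun _ => ht.1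
  rw [hone, hzero]
  simp

lemma MemH.distortion_mono (hh : MemH h) {Z Z' : Ω → ℝ} (hZ : IsBdd Z) (hZ' : IsBdd Z')
    (hle : ∀ ω, Z ω ≤ Z' ω) : distortion P h Z ≤ distortion P h Z' := by
  obtain ⟨M, hM⟩ := hZ
  obtain ⟨M', hM'⟩ := hZ'
  have hK : 0 ≤ max 0 (max M M') := le_max_left _ _
  have hMK : M ≤ max 0 (max M M') := by simp
  have hMK' : M' ≤ max 0 (max M M') := by simp
  generalize max 0 (max M M') = K at *
  rw [hh.distortion_eq (lo := -K) (hi := K) (by linarith) hK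
      fun ω => abs_le.1 ((hM ω).trans hMK),
    hh.distortion_eq (lo := -K) (hi := K) (by linarith) hK
      fun ω => abs_le.1 ((hM' ω).trans hMK')]
  gcongr
  refine intervalIntegral.integral_mono_on (by linarith)
    (hh.distSurvival_intervalIntegrable _ _ _) (hh.distSurvival_intervalIntegrable _ _ _)
    fun t _ => hh.apply_measure_mono fun ω hω => le_trans hω (hle ω)

lemma MemH.distortion_mono_distortion {g : ℝ → ℝ} (hh : MemH h) (hg : MemH g)
    (hle : ∀ x, h x ≤ g x) {Z : Ω → ℝ} (hZ : IsBdd Z) :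
    distortion P h Z ≤ distortion P g Z := by
  obtain ⟨M, hM⟩ := hZ
  have hK : 0 ≤ max 0 M := le_max_left _ _
  have hMK : M ≤ max 0 M := le_max_right _ _
  generalize max 0 M = K at *
  have hZK (ω) := abs_le.1 ((hM ω).trans hMK)
  rw [hh.distortion_eq (by linarith) hK hZK, hg.distortion_eq (by linarith) hK hZK]
  gcongr
  exact intervalIntegral.integral_mono_on (by linarith)
    (hh.distSurvival_intervalIntegrable _ _ _) (hg.distSurvival_intervalIntegrable _ _ _)
    fun t _ => hle _

lemma MemH.distortion_add_const (hh : MemH h) {Z : Ω → ℝ} (hZ : IsBdd Z) (c : ℝ) :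
    distortion P h (fun ω => Z ω + c) = distortion P h Z + c := by
  obtain ⟨M, hM⟩ := hZ
  have hMK : M ≤ max 0 M + |c| := by
    have := le_max_right 0 M
    have := abs_nonneg c
    linarith
  have hcK : |c| ≤ max 0 M + |c| := by
    have := le_max_left 0 M
    linarith
  generalize max 0 M + |c| = K at *
  have hZK (ω) := abs_le.1 ((hM ω).trans hMK)
  have hc := abs_le.1 hcK
  have hK : 0 ≤ K := (abs_nonneg c).trans hcK
  rw [hh.distortion_eq (by linarith) hK hZK,
    hh.distortion_eq (lo := -K + c) (hi := K + c) (by linarith) (by linarith)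
      fun ω => ⟨by linarith [(hZK ω).1], by linarith [(hZK ω).2]⟩]
  have : distSurvival P h (fun ω => Z ω + c) = fun t => distSurvival P h Z (t - c) := by
    funext t
    simp only [distSurvival, sub_le_iff_le_add]
  rw [this, intervalIntegral.integral_comp_sub_right (fun t => distSurvival P h Z t)]
  simp only [add_sub_cancel_right]
  ring

/-- A bound on the distorted survival functions on `(a, b]`, with domination elsewhere,
bounds the increment of the distortion risk measure. -/
lemma MemH.distortion_le_add (hh : MemH h) {Z Z' : Ω → ℝ} (hZ : IsBdd Z) (hZ' : IsBdd Z')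
    {a b c : ℝ} (hab : a ≤ b)
    (hin : ∀ t ∈ Ioc a b, distSurvival P h Z' t ≤ distSurvival P h Z t + c)
    (hout : ∀ t ∉ Ioc a b, distSurvival P h Z' t ≤ distSurvival P h Z t) :
    distortion P h Z' ≤ distortion P h Z + c * (b - a) := by
  obtain ⟨M, hM⟩ := hZ
  obtain ⟨M', hM'⟩ := hZ'
  obtain ⟨K, hMK, hMK', haK, hbK⟩ : ∃ K, M ≤ K ∧ M' ≤ K ∧ |a| ≤ K ∧ |b| ≤ K :=
    ⟨max (max M M') (max |a| |b|), by simp, by simp, by simp, by simp⟩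
  have hK : 0 ≤ K := (abs_nonneg a).trans haK
  rw [abs_le] at haK hbK
  rw [hh.distortion_eq (lo := -K) (hi := K) (by linarith) hK
      fun ω => abs_le.1 ((hM ω).trans hMK),
    hh.distortion_eq (lo := -K) (hi := K) (by linarith) hK
      fun ω => abs_le.1 ((hM' ω).trans hMK')]
  have hI (x y) := hh.distSurvival_intervalIntegrable (P := P) Z x y
  have hI' (x y) := hh.distSurvival_intervalIntegrable (P := P) Z' x y
  have hsplit := intervalIntegral.integral_add_adjacent_intervals (hI (-K) a) (hI a K)
  have hsplit₂ := intervalIntegral.integral_add_adjacent_intervals (hI a b) (hI b K)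
  have hsplit' := intervalIntegral.integral_add_adjacent_intervals (hI' (-K) a) (hI' a K)
  have hsplit₂' := intervalIntegral.integral_add_adjacent_intervals (hI' a b) (hI' b K)
  have hleft : ∫ t in (-K)..a, distSurvival P h Z' t ≤ ∫ t in (-K)..a, distSurvival P h Z t :=
    intervalIntegral.integral_mono_on haK.1 (hI' _ _) (hI _ _)
      fun t ht => hout t fun h => absurd h.1 ht.2.not_gt
  have hright : ∫ t in b..K, distSurvival P h Z' t ≤ ∫ t in b..K, distSurvival P h Z t :=
    intervalIntegral.integral_mono_on_of_le_Ioo hbK.2 (hI' _ _) (hI _ _)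
      fun t ht => hout t fun h => absurd h.2 ht.1.not_ge
  have hmid : ∫ t in a..b, distSurvival P h Z' t ≤ ∫ t in a..b, (distSurvival P h Z t + c) :=
    intervalIntegral.integral_mono_on_of_le_Ioo hab (hI' _ _)
      ((hI _ _).add intervalIntegrable_const) fun t ht => hin t ⟨ht.1, ht.2.le⟩
  rw [intervalIntegral.integral_add (hI _ _) intervalIntegrable_const,
    intervalIntegral.integral_const, smul_eq_mul] at hmid
  linarith

end Basic

section Step

variable {P : Measure Ω} [IsProbabilityMeasure P] {h : ℝ → ℝ}
  {Z Z' : Ω → ℝ} {A : Set Ω} {v v' : ℝ}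

lemma distSurvival_eq_of_notMem_Ioc (hA : ∀ ω ∈ A, Z ω = v) (hA' : ∀ ω ∈ A, Z' ω = v')
    (hAc : ∀ ω ∉ A, Z' ω = Z ω) {t : ℝ} (ht : t ≤ v ↔ t ≤ v') :
    distSurvival P h Z' t = distSurvival P h Z t := by
  have : {ω | t ≤ Z' ω} = {ω | t ≤ Z ω} := by
    ext ω
    by_cases hω : ω ∈ A
    · simp [hA ω hω, hA' ω hω, ht]
    · simp [hAc ω hω]
  rw [distSurvival, distSurvival, this]

/-- Raising a variable from `v` to `v'` on `A`: upper bound for subadditive `h`. -/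
lemma MemH.distortion_raise_le_of_subadditive (hh : MemH h)
    (hsub : ∀ x y : ℝ, 0 ≤ x → 0 ≤ y → x + y ≤ 1 → h (x + y) ≤ h x + h y)
    (hZ : IsBdd Z) (hZ' : IsBdd Z') (hmA : MeasurableSet A)
    (hA : ∀ ω ∈ A, Z ω = v) (hA' : ∀ ω ∈ A, Z' ω = v') (hAc : ∀ ω ∉ A, Z' ω = Z ω)
    (hv : v ≤ v') :
    distortion P h Z' ≤ distortion P h Z + h (P A).toReal * (v' - v) := by
  refine hh.distortion_le_add hZ hZ' hv (fun t ht => ?_) fun t ht =>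
    (distSurvival_eq_of_notMem_Ioc hA hA' hAc ?_).le
  · have hset : {ω | t ≤ Z' ω} = {ω | t ≤ Z ω} ∪ A := by
      ext ω
      by_cases hω : ω ∈ A
      · simp [hω, hA' ω hω, ht.2]
      · simp [hω, hAc ω hω]
    have hdisj : Disjoint {ω | t ≤ Z ω} A := by
      rw [Set.disjoint_left]
      intro ω h1 h2
      exact absurd ht.1 (not_lt.2 (hA ω h2 ▸ h1))
    have hP : (P {ω | t ≤ Z' ω}).toReal = (P {ω | t ≤ Z ω}).toReal + (P A).toReal := by
      rw [hset, measure_union hdisj hmA,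
        ENNReal.toReal_add (measure_ne_top _ _) (measure_ne_top _ _)]
    have := (toReal_mem_Icc P {ω | t ≤ Z' ω}).2
    rw [distSurvival, distSurvival, hP]
    exact hsub _ _ ENNReal.toReal_nonneg ENNReal.toReal_nonneg (hP ▸ this)
  · exact ⟨fun h1 => h1.trans hv, fun h1 => not_lt.1 fun h2 => ht ⟨h2, h1⟩⟩

/-- Raising a variable on its top level set `A`: upper bound. -/
lemma MemH.distortion_raise_le (hh : MemH h) (hZ : IsBdd Z) (hZ' : IsBdd Z')
    (hA : ∀ ω ∈ A, Z ω = v) (hA' : ∀ ω ∈ A, Z' ω = v') (hAc : ∀ ω ∉ A, Z' ω = Z ω)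
    (hv : v ≤ v') (htop : ∀ ω, Z ω ≤ v) :
    distortion P h Z' ≤ distortion P h Z + h (P A).toReal * (v' - v) := by
  refine hh.distortion_le_add hZ hZ' hv (fun t ht => ?_) fun t ht =>
    (distSurvival_eq_of_notMem_Ioc hA hA' hAc ?_).le
  · rw [hh.distSurvival_eq_zero fun ω => (htop ω).trans_lt ht.1, zero_add]
    refine hh.apply_measure_mono fun ω hω => ?_
    by_contra hc
    have h1 : t ≤ Z' ω := hω
    rw [hAc ω hc] at h1
    exact absurd (h1.trans (htop ω)) ht.1.not_ge
  · exact ⟨fun h1 => h1.trans hv, fun h1 => not_lt.1 fun h2 => ht ⟨h2, h1⟩⟩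

/-- Raising a variable on its top level set `A`: lower bound. -/
lemma MemH.le_distortion_raise (hh : MemH h) (hZ : IsBdd Z) (hZ' : IsBdd Z')
    (hA : ∀ ω ∈ A, Z ω = v) (hA' : ∀ ω ∈ A, Z' ω = v') (hAc : ∀ ω ∉ A, Z' ω = Z ω)
    (hv : v ≤ v') (htop : ∀ ω, Z ω ≤ v) :
    distortion P h Z + h (P A).toReal * (v' - v) ≤ distortion P h Z' := by
  have := hh.distortion_le_add (P := P) (c := -h (P A).toReal) hZ' hZ hv (fun t ht => ?_)
    fun t ht => (distSurvival_eq_of_notMem_Ioc hA hA' hAc ?_).ge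
  · linarith
  · rw [hh.distSurvival_eq_zero fun ω => (htop ω).trans_lt ht.1]
    have : h (P A).toReal ≤ distSurvival P h Z' t :=
      hh.apply_measure_mono fun ω hω => by
        change t ≤ Z' ω
        rw [hA' ω hω]
        exact ht.2
    linarith
  · exact ⟨fun h1 => h1.trans hv, fun h1 => not_lt.1 fun h2 => ht ⟨h2, h1⟩⟩

/-- Lowering a variable from `v` to `v'` on `A`: upper bound when the dual of `h` is
superadditive. -/
lemma MemH.distortion_lower_le_of_dual_superadditive (hh : MemH h)
    (hsup : ∀ x y : ℝ, 0 ≤ x → 0 ≤ y → x + y ≤ 1 →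
      (1 - h (1 - x)) + (1 - h (1 - y)) ≤ 1 - h (1 - (x + y)))
    (hZ : IsBdd Z) (hZ' : IsBdd Z') (hmA : MeasurableSet A)
    (hA : ∀ ω ∈ A, Z ω = v) (hA' : ∀ ω ∈ A, Z' ω = v') (hAc : ∀ ω ∉ A, Z' ω = Z ω)
    (hv : v' ≤ v) :
    distortion P h Z' ≤ distortion P h Z + (1 - h (P Aᶜ).toReal) * (v' - v) := by
  have := hh.distortion_le_add (P := P) (c := -(1 - h (P Aᶜ).toReal)) hZ hZ' hv
    (fun t ht => ?_) fun t ht => (distSurvival_eq_of_notMem_Ioc hA hA' hAc ?_).le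
  · linarith
  · have hset : {ω | t ≤ Z ω} = {ω | t ≤ Z' ω} ∪ A := by
      ext ω
      by_cases hω : ω ∈ A
      · simp [hω, hA ω hω, ht.2]
      · simp [hω, hAc ω hω]
    have hdisj : Disjoint {ω | t ≤ Z' ω} A := by
      rw [Set.disjoint_left]
      intro ω h1 h2
      exact absurd ht.1 (not_lt.2 (hA' ω h2 ▸ h1))
    have hP : (P {ω | t ≤ Z ω}).toReal = (P {ω | t ≤ Z' ω}).toReal + (P A).toReal := by
      rw [hset, measure_union hdisj hmA,
        ENNReal.toReal_add (measure_ne_top _ _) (measure_ne_top _ _)]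
    have hAcompl : (P Aᶜ).toReal = 1 - (P A).toReal := probReal_compl_eq_one_sub hmA
    have h1 := (toReal_mem_Icc P {ω | t ≤ Z ω}).2
    have h2 := (toReal_mem_Icc P {ω | t ≤ Z' ω}).1
    have key := hsup (1 - (P {ω | t ≤ Z ω}).toReal) (P A).toReal (by linarith)
      ENNReal.toReal_nonneg (by linarith)
    rw [sub_sub_cancel, ← hAcompl,
      show 1 - (1 - (P {ω | t ≤ Z ω}).toReal + (P A).toReal) = (P {ω | t ≤ Z' ω}).toReal by
        linarith] at key
    simp only [distSurvival]
    linarith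
  · exact ⟨fun h1 => not_lt.1 fun h2 => ht ⟨h2, h1⟩, fun h1 => h1.trans hv⟩

/-- Lowering a variable on its bottom level set `A`: lower bound. -/
lemma MemH.le_distortion_lower (hh : MemH h) (hZ : IsBdd Z) (hZ' : IsBdd Z')
    (hA : ∀ ω ∈ A, Z ω = v) (hA' : ∀ ω ∈ A, Z' ω = v') (hAc : ∀ ω ∉ A, Z' ω = Z ω)
    (hv : v' ≤ v) (hbot : ∀ ω, v ≤ Z ω) :
    distortion P h Z + (1 - h (P Aᶜ).toReal) * (v' - v) ≤ distortion P h Z' := by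
  have := hh.distortion_le_add (P := P) (c := 1 - h (P Aᶜ).toReal) hZ' hZ hv (fun t ht => ?_)
    fun t ht => (distSurvival_eq_of_notMem_Ioc hA hA' hAc ?_).ge
  · linarith
  · rw [hh.distSurvival_eq_one fun ω => ht.2.trans (hbot ω)]
    have : h (P Aᶜ).toReal ≤ distSurvival P h Z' t :=
      hh.apply_measure_mono fun ω hω => by
        change t ≤ Z' ω
        rw [hAc ω hω]
        exact ht.2.trans (hbot ω)
    linarith
  · exact ⟨fun h1 => not_lt.1 fun h2 => ht ⟨h2, h1⟩, fun h1 => h1.trans hv⟩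

end Step

section Chain

variable {P : Measure Ω} [IsProbabilityMeasure P] {h : ℝ → ℝ} {W : Ω → ℕ}

lemma isBdd_comp_min (z : ℕ → ℝ) (W : Ω → ℕ) (k : ℕ) : IsBdd fun ω => z (min (W ω) k) :=
  ⟨∑ i ∈ Finset.range (k + 1), |z i|, fun _ =>
    Finset.single_le_sum (f := fun i => |z i|) (fun _ _ => abs_nonneg _)
      (Finset.mem_range.2 (Nat.lt_succ_of_le (min_le_right _ _)))⟩

lemma comp_min_of_lt {z : ℕ → ℝ} {k : ℕ} : ∀ ω ∈ {ω | k < W ω}, z (min (W ω) k) = z k :=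
  fun ω hω => by rw [min_eq_right (le_of_lt hω)]

lemma comp_min_succ_of_lt {z : ℕ → ℝ} {k : ℕ} :
    ∀ ω ∈ {ω | k < W ω}, z (min (W ω) (k + 1)) = z (k + 1) :=
  fun ω hω => by rw [min_eq_right (Nat.succ_le_of_lt hω)]

lemma comp_min_succ_of_not_lt {z : ℕ → ℝ} {k : ℕ} :
    ∀ ω ∉ {ω | k < W ω}, z (min (W ω) (k + 1)) = z (min (W ω) k) := fun ω hω => by
  have : W ω ≤ k := not_lt.1 hω
  rw [min_eq_left this, min_eq_left (this.trans k.le_succ)]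

lemma MemH.distortion_add_le_of_monotone_monotone (hh : MemH h) {x y : ℕ → ℝ}
    (hx : Monotone x) (hy : Monotone y) (k : ℕ) :
    distortion P h (fun ω => x (min (W ω) k) + y (min (W ω) k)) ≤
      distortion P h (fun ω => x (min (W ω) k)) + distortion P h (fun ω => y (min (W ω) k)) := by
  induction k with
  | zero => simp [hh.distortion_const]
  | succ k ih =>
    have hX := hh.le_distortion_raise (P := P) (isBdd_comp_min x W k)
      (isBdd_comp_min x W (k + 1)) comp_min_of_lt comp_min_succ_of_lt
      comp_min_succ_of_not_lt (hx k.le_succ) fun ω => hx (min_le_right _ _)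
    have hY := hh.le_distortion_raise (P := P) (isBdd_comp_min y W k)
      (isBdd_comp_min y W (k + 1)) comp_min_of_lt comp_min_succ_of_lt
      comp_min_succ_of_not_lt (hy k.le_succ) fun ω => hy (min_le_right _ _)
    have hZ := hh.distortion_raise_le (P := P) (isBdd_comp_min (x + y) W k)
      (isBdd_comp_min (x + y) W (k + 1)) comp_min_of_lt comp_min_succ_of_lt
      comp_min_succ_of_not_lt ((hx.add hy) k.le_succ) fun ω => (hx.add hy) (min_le_right _ _)
    simp only [Pi.add_apply] at hZ
    linarith

lemma MemH.distortion_add_le_of_monotone_antitone (hh : MemH h) (hd : DuallySubadditive h)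
    (hW : Measurable W) {x y : ℕ → ℝ} (hx : Monotone x) (hy : Antitone y) (k : ℕ) :
    distortion P h (fun ω => x (min (W ω) k) + y (min (W ω) k)) ≤
      distortion P h (fun ω => x (min (W ω) k)) + distortion P h (fun ω => y (min (W ω) k)) := by
  induction k with
  | zero => simp [hh.distortion_const]
  | succ k ih =>
    have hmA : MeasurableSet {ω | k < W ω} := hW measurableSet_Ioi
    have hX := hh.le_distortion_raise (P := P) (isBdd_comp_min x W k)
      (isBdd_comp_min x W (k + 1)) comp_min_of_lt comp_min_succ_of_lt
      comp_min_succ_of_not_lt (hx k.le_succ) fun ω => hx (min_le_right _ _)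
    have hY := hh.le_distortion_lower (P := P) (isBdd_comp_min y W k)
      (isBdd_comp_min y W (k + 1)) comp_min_of_lt comp_min_succ_of_lt
      comp_min_succ_of_not_lt (hy k.le_succ) fun ω => hy (min_le_right _ _)
    have hone : 1 - h (P {ω | k < W ω}ᶜ).toReal ≤ h (P {ω | k < W ω}).toReal := by
      have hc : (P {ω | k < W ω}ᶜ).toReal = 1 - (P {ω | k < W ω}).toReal :=
        probReal_compl_eq_one_sub hmA
      have := hd.1 (P {ω | k < W ω}).toReal (P {ω | k < W ω}ᶜ).toReal
        ENNReal.toReal_nonneg ENNReal.toReal_nonneg (by linarith)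
      rw [hc, add_sub_cancel, hh.2.2] at this
      rw [hc]
      linarith
    have hdx : 0 ≤ x (k + 1) - x k := sub_nonneg.2 (hx k.le_succ)
    have hdy : 0 ≤ y k - y (k + 1) := sub_nonneg.2 (hy k.le_succ)
    rcases le_total ((x + y) k) ((x + y) (k + 1)) with hle | hle
    · have hZ := hh.distortion_raise_le_of_subadditive (P := P) hd.1 (isBdd_comp_min (x + y) W k)
        (isBdd_comp_min (x + y) W (k + 1)) hmA comp_min_of_lt comp_min_succ_of_lt
        comp_min_succ_of_not_lt hle
      simp only [Pi.add_apply] at hZ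
      nlinarith [mul_le_mul_of_nonneg_right hone hdy]
    · have hZ := hh.distortion_lower_le_of_dual_superadditive (P := P) hd.2
        (isBdd_comp_min (x + y) W k) (isBdd_comp_min (x + y) W (k + 1)) hmA comp_min_of_lt
        comp_min_succ_of_lt comp_min_succ_of_not_lt hle
      simp only [Pi.add_apply] at hZ
      nlinarith [mul_le_mul_of_nonneg_right hone hdx]

end Chain

section Discrete

variable {P : Measure Ω} [IsProbabilityMeasure P] {h : ℝ → ℝ}

/-- A bounded function that is increasing along `W` on `G` factors through `W` on `G`
via a monotone function. -/
lemma exists_monotone_factor {α : Type*} {X : α → ℝ} {W : α → ℕ} {G : Set α}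
    (hX : ∃ M, ∀ a, |X a| ≤ M)
    (hXW : ∀ a ∈ G, ∀ b ∈ G, W a ≤ W b → X a ≤ X b) :
    ∃ x : ℕ → ℝ, Monotone x ∧ ∀ a ∈ G, X a = x (W a) := by
  obtain ⟨M, hM⟩ := hX
  have hbdd (i : ℕ) : BddAbove (range fun a : G => if W a ≤ i then X a else -M) := by
    refine ⟨|M|, ?_⟩
    rintro _ ⟨a, rfl⟩
    dsimp only
    split_ifs
    · exact (le_abs_self _).trans ((hM a).trans (le_abs_self M))
    · exact neg_le_abs M
  refine ⟨fun i => ⨆ a : G, if W a ≤ i then X a else -M, fun i j hij => ?_, fun a ha => ?_⟩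
  · refine ciSup_mono (hbdd j) fun a => ?_
    split_ifs with h1 h2 h2
    · exact le_rfl
    · exact absurd (h1.trans hij) h2
    · exact (abs_le.1 (hM a)).1
    · exact le_rfl
  · have : Nonempty G := ⟨⟨a, ha⟩⟩
    refine le_antisymm ?_ (ciSup_le fun b => ?_)
    · simpa using le_ciSup (hbdd (W a)) ⟨a, ha⟩
    · split_ifs with h1
      · exact hXW b b.2 a ha h1
      · exact (abs_le.1 (hM a)).1

/-- An almost sure relation between two independent copies of a discrete variable holds
everywhere on a set of full measure. -/
lemma ae_pairwise_of_countable {β : Type*} [Countable β] [MeasurableSpace β]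
    [MeasurableSingletonClass β] {V : Ω → β} (hV : Measurable V) {r : β → β → Prop}
    (hr : ∀ᵐ p ∂(P.prod P), r (V p.1) (V p.2)) :
    ∃ G : Set Ω, (∀ᵐ ω ∂P, ω ∈ G) ∧ ∀ a ∈ G, ∀ b ∈ G, r (V a) (V b) := by
  refine ⟨{ω | P (V ⁻¹' {V ω}) ≠ 0}, ?_, fun a ha b hb => ?_⟩
  · have : ∀ᵐ v ∂(P.map V), P (V ⁻¹' {v}) ≠ 0 := by
      rw [ae_iff_of_countable]
      intro v hv
      rwa [Measure.map_apply hV (measurableSet_singleton v)] at hv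
    exact ae_of_ae_map hV.aemeasurable this
  · have hne : (P.prod P) ((V ⁻¹' {V a}) ×ˢ (V ⁻¹' {V b})) ≠ 0 := by
      rw [Measure.prod_prod]
      exact mul_ne_zero ha hb
    obtain ⟨p, ⟨hp1, hp2⟩, hp⟩ := ((frequently_ae_mem_iff.2 hne).and_eventually hr).exists
    rw [mem_preimage, mem_singleton_iff] at hp1 hp2
    rwa [hp1, hp2] at hp

lemma exists_measurable_nat_index {D : Ω → ℤ} (hD : Measurable D) {K : ℤ} (hK : ∀ ω, |D ω| ≤ K) :
    ∃ (W : Ω → ℕ) (N : ℕ), Measurable W ∧ (∀ ω, W ω ≤ N) ∧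
      ∀ a b, W a ≤ W b → D a ≤ D b := by
  refine ⟨fun ω => (D ω + K).toNat, (2 * K).toNat,
    (measurable_of_countable fun d : ℤ => (d + K).toNat).comp hD, fun ω => ?_, fun a b hab => ?_⟩
  · have := abs_le.1 (hK ω)
    dsimp only
    omega
  · have := abs_le.1 (hK a)
    have := abs_le.1 (hK b)
    dsimp only at hab
    omega

lemma MemH.distortion_add_le_of_discrete_comonotone (hh : MemH h) {A B : Ω → ℤ}
    (hA : Measurable A) (hB : Measurable B) {K : ℤ} (hAK : ∀ ω, |A ω| ≤ K) (hBK : ∀ ω, |B ω| ≤ K)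
    {ε : ℝ} (hε : 0 ≤ ε)
    (hAB : ∀ᵐ p ∂(P.prod P), 0 ≤ (A p.1 - A p.2) * (B p.1 - B p.2)) :
    distortion P h (fun ω => ε * A ω + ε * B ω) ≤
      distortion P h (fun ω => ε * A ω) + distortion P h (fun ω => ε * B ω) := by
  obtain ⟨G, hG, hGr⟩ := ae_pairwise_of_countable (P := P) (hA.prodMk hB)
    (r := fun u v => 0 ≤ (u.1 - v.1) * (u.2 - v.2)) hAB
  obtain ⟨W, N, -, hWN, hW⟩ := exists_measurable_nat_index (hA.add hB) (K := K + K)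
    fun ω => (abs_add_le _ _).trans (add_le_add (hAK ω) (hBK ω))
  have hscale (C : Ω → ℤ) (hC : ∀ ω, |C ω| ≤ K) : ∃ M, ∀ ω, |ε * C ω| ≤ M := by
    refine ⟨ε * K, fun ω => ?_⟩
    rw [abs_mul, abs_of_nonneg hε]
    exact mul_le_mul_of_nonneg_left (by exact_mod_cast hC ω) hε
  obtain ⟨x, hx, hxA⟩ := exists_monotone_factor (X := fun ω => ε * A ω) (W := W) (G := G)
    (hscale A hAK) fun a ha b hb hab => by
      have h1 := hW a b hab
      have h2 := hGr a ha b hb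
      refine mul_le_mul_of_nonneg_left ?_ hε
      simp only [Pi.add_apply] at h1
      have : A a ≤ A b := by
        by_contra! hc
        nlinarith
      exact_mod_cast this
  obtain ⟨y, hy, hyB⟩ := exists_monotone_factor (X := fun ω => ε * B ω) (W := W) (G := G)
    (hscale B hBK) fun a ha b hb hab => by
      have h1 := hW a b hab
      have h2 := hGr a ha b hb
      refine mul_le_mul_of_nonneg_left ?_ hε
      simp only [Pi.add_apply] at h1
      have : B a ≤ B b := by
        by_contra! hc
        nlinarith
      exact_mod_cast this
  have key := hh.distortion_add_le_of_monotone_monotone (P := P) (W := W) hx hy N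
  simp only [min_eq_left (hWN _)] at key
  rwa [distortion_congr_ae (Z := fun ω => ε * A ω) (hG.mono hxA),
    distortion_congr_ae (Z := fun ω => ε * B ω) (hG.mono hyB),
    distortion_congr_ae (Z := fun ω => ε * A ω + ε * B ω) (Z' := fun ω => x (W ω) + y (W ω))
      (hG.mono fun ω hω => congrArg₂ (· + ·) (hxA ω hω) (hyB ω hω))]

lemma MemH.distortion_add_le_of_discrete_counterMonotone (hh : MemH h) (hd : DuallySubadditive h)
    {A B : Ω → ℤ} (hA : Measurable A) (hB : Measurable B) {K : ℤ}
    (hAK : ∀ ω, |A ω| ≤ K) (hBK : ∀ ω, |B ω| ≤ K) {ε : ℝ} (hε : 0 ≤ ε)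
    (hAB : ∀ᵐ p ∂(P.prod P), (A p.1 - A p.2) * (B p.1 - B p.2) ≤ 0) :
    distortion P h (fun ω => ε * A ω + ε * B ω) ≤
      distortion P h (fun ω => ε * A ω) + distortion P h (fun ω => ε * B ω) := by
  obtain ⟨G, hG, hGr⟩ := ae_pairwise_of_countable (P := P) (hA.prodMk hB)
    (r := fun u v => (u.1 - v.1) * (u.2 - v.2) ≤ 0) hAB
  obtain ⟨W, N, hWm, hWN, hW⟩ := exists_measurable_nat_index (hA.sub hB) (K := K + K)
    fun ω => (abs_sub _ _).trans (add_le_add (hAK ω) (hBK ω))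
  obtain ⟨x, hx, hxA⟩ := exists_monotone_factor (X := fun ω => ε * A ω) (W := W) (G := G)
    ⟨ε * K, fun ω => by
      rw [abs_mul, abs_of_nonneg hε]
      exact mul_le_mul_of_nonneg_left (by exact_mod_cast hAK ω) hε⟩ fun a ha b hb hab => by
      have h1 := hW a b hab
      have h2 := hGr a ha b hb
      refine mul_le_mul_of_nonneg_left ?_ hε
      simp only [Pi.sub_apply] at h1
      have : A a ≤ A b := by
        by_contra! hc
        nlinarith
      exact_mod_cast this
  obtain ⟨y, hy, hyB⟩ := exists_monotone_factor (X := fun ω => -(ε * B ω)) (W := W) (G := G)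
    ⟨ε * K, fun ω => by
      rw [abs_neg, abs_mul, abs_of_nonneg hε]
      exact mul_le_mul_of_nonneg_left (by exact_mod_cast hBK ω) hε⟩ fun a ha b hb hab => by
      have h1 := hW a b hab
      have h2 := hGr a ha b hb
      refine neg_le_neg (mul_le_mul_of_nonneg_left ?_ hε)
      simp only [Pi.sub_apply] at h1
      have : B b ≤ B a := by
        by_contra! hc
        nlinarith
      exact_mod_cast this
  have hyB' : ∀ ω ∈ G, ε * B ω = (-y) (W ω) := fun ω hω => by
    rw [Pi.neg_apply, ← hyB ω hω, neg_neg]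
  have key := hh.distortion_add_le_of_monotone_antitone (P := P) hd hWm hx hy.neg N
  simp only [min_eq_left (hWN _)] at key
  rwa [distortion_congr_ae (Z := fun ω => ε * A ω) (hG.mono hxA),
    distortion_congr_ae (Z := fun ω => ε * B ω) (hG.mono hyB'),
    distortion_congr_ae (Z := fun ω => ε * A ω + ε * B ω) (Z' := fun ω => x (W ω) + (-y) (W ω))
      (hG.mono fun ω hω => congrArg₂ (· + ·) (hxA ω hω) (hyB' ω hω))]

end Discrete

section Pair

variable {P : Measure Ω} [IsProbabilityMeasure P] {h : ℝ → ℝ} {X Y : Ω → ℝ}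

lemma floor_mul_floor_nonneg {a a' b b' : ℝ} (hab : 0 ≤ (a - a') * (b - b')) :
    0 ≤ (⌊a⌋ - ⌊a'⌋) * (⌊b⌋ - ⌊b'⌋) := by
  rcases mul_nonneg_iff.1 hab with ⟨h1, h2⟩ | ⟨h1, h2⟩
  · exact mul_nonneg (sub_nonneg.2 (Int.floor_le_floor (sub_nonneg.1 h1)))
      (sub_nonneg.2 (Int.floor_le_floor (sub_nonneg.1 h2)))
  · exact mul_nonneg_of_nonpos_of_nonpos (sub_nonpos.2 (Int.floor_le_floor (sub_nonpos.1 h1)))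
      (sub_nonpos.2 (Int.floor_le_floor (sub_nonpos.1 h2)))

lemma floor_mul_floor_nonpos {a a' b b' : ℝ} (hab : (a - a') * (b - b') ≤ 0) :
    (⌊a⌋ - ⌊a'⌋) * (⌊b⌋ - ⌊b'⌋) ≤ 0 := by
  rcases mul_nonpos_iff.1 hab with ⟨h1, h2⟩ | ⟨h1, h2⟩
  · exact mul_nonpos_of_nonneg_of_nonpos (sub_nonneg.2 (Int.floor_le_floor (sub_nonneg.1 h1)))
      (sub_nonpos.2 (Int.floor_le_floor (sub_nonpos.1 h2)))
  · exact mul_nonpos_of_nonpos_of_nonneg (sub_nonpos.2 (Int.floor_le_floor (sub_nonpos.1 h1)))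
      (sub_nonneg.2 (Int.floor_le_floor (sub_nonneg.1 h2)))

lemma IsBdd.add (hX : IsBdd X) (hY : IsBdd Y) : IsBdd fun ω => X ω + Y ω := by
  obtain ⟨M, hM⟩ := hX
  obtain ⟨M', hM'⟩ := hY
  exact ⟨M + M', fun ω => (abs_add_le _ _).trans (add_le_add (hM ω) (hM' ω))⟩

lemma isBdd_const (c : ℝ) : IsBdd fun _ : Ω => c := ⟨|c|, fun _ => le_rfl⟩

lemma exists_abs_floor_le (hX : IsBdd X) {ε : ℝ} (hε : 0 < ε) :
    ∃ K : ℤ, ∀ ω, |⌊X ω / ε⌋| ≤ K := by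
  obtain ⟨M, hM⟩ := hX
  refine ⟨⌈M / ε⌉, fun ω => abs_le.2 ⟨?_, ?_⟩⟩
  · rw [← Int.floor_neg, ← neg_div]
    exact Int.floor_le_floor (div_le_div_of_nonneg_right (abs_le.1 (hM ω)).1 hε.le)
  · exact (Int.floor_le_ceil _).trans
      (Int.ceil_le_ceil (div_le_div_of_nonneg_right (abs_le.1 (hM ω)).2 hε.le))

/-- Subadditivity of a distortion risk measure on a pair passes from its discretizations
to the pair itself. -/
lemma MemH.distortion_add_le_of_discretizations (hh : MemH h) (hX : IsBdd X) (hY : IsBdd Y)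
    (hdisc : ∀ ε : ℝ, 0 < ε →
      distortion P h (fun ω => ε * (⌊X ω / ε⌋ : ℤ) + ε * (⌊Y ω / ε⌋ : ℤ)) ≤
        distortion P h (fun ω => ε * (⌊X ω / ε⌋ : ℤ)) +
          distortion P h (fun ω => ε * (⌊Y ω / ε⌋ : ℤ))) :
    distortion P h (fun ω => X ω + Y ω) ≤ distortion P h X + distortion P h Y := by
  refine le_of_forall_pos_le_add fun δ hδ => ?_
  have hε : 0 < δ / 2 := by linarith
  have hδε : δ = δ / 2 + δ / 2 := by ring
  have hstep := hdisc _ hε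
  generalize δ / 2 = ε at *
  have hlow (t : ℝ) : ε * (⌊t / ε⌋ : ℤ) ≤ t := by
    have := Int.floor_le (t / ε)
    rw [le_div_iff₀ hε] at this
    linarith
  have hupp (t : ℝ) : t ≤ ε * (⌊t / ε⌋ : ℤ) + ε := by
    have := (Int.lt_floor_add_one (t / ε)).le
    rw [div_le_iff₀ hε] at this
    linarith
  have hb {Z : Ω → ℝ} (hZ : IsBdd Z) : IsBdd fun ω => ε * (⌊Z ω / ε⌋ : ℤ) := by
    obtain ⟨K, hK⟩ := exists_abs_floor_le hZ hε
    refine ⟨ε * K, fun ω => ?_⟩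
    rw [abs_mul, abs_of_pos hε]
    exact mul_le_mul_of_nonneg_left (by exact_mod_cast hK ω) hε.le
  have h1 := hh.distortion_mono (P := P) (hb hX) hX fun ω => hlow _
  have h2 := hh.distortion_mono (P := P) (hb hY) hY fun ω => hlow _
  have h3 := hh.distortion_mono (P := P) (hX.add hY)
    (((hb hX).add (hb hY)).add (isBdd_const δ)) fun ω => by linarith [hupp (X ω), hupp (Y ω)]
  rw [hh.distortion_add_const ((hb hX).add (hb hY))] at h3
  linarith

lemma MemLinf.isBdd (hX : MemLinf X) : IsBdd X := hX.2

lemma MemLinf.measurable_floor_div (hX : MemLinf X) (ε : ℝ) :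
    Measurable fun ω => ⌊X ω / ε⌋ :=
  Int.measurable_floor.comp (hX.1.div_const ε)

lemma div_sub_div_mul_div_sub_div (a a' b b' ε : ℝ) :
    (a / ε - a' / ε) * (b / ε - b' / ε) = (a - a') * (b - b') / (ε * ε) := by
  rw [← sub_div, ← sub_div, div_mul_div_comm]

/-- Distortion risk measures are subadditive on comonotonic pairs. -/
lemma MemH.distortion_add_le_of_comonotone (hh : MemH h) (hX : MemLinf X) (hY : MemLinf Y)
    (hXY : Comonotone P X Y) :
    distortion P h (fun ω => X ω + Y ω) ≤ distortion P h X + distortion P h Y := by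
  refine hh.distortion_add_le_of_discretizations hX.isBdd hY.isBdd fun ε hε => ?_
  obtain ⟨K, hK⟩ := exists_abs_floor_le hX.isBdd hε
  obtain ⟨K', hK'⟩ := exists_abs_floor_le hY.isBdd hε
  refine hh.distortion_add_le_of_discrete_comonotone (hX.measurable_floor_div ε)
    (hY.measurable_floor_div ε) (fun ω => (hK ω).trans (le_max_left K K'))
    (fun ω => (hK' ω).trans (le_max_right K K')) hε.le (hXY.mono fun p hp => ?_)
  refine floor_mul_floor_nonneg ?_
  rw [div_sub_div_mul_div_sub_div]
  exact div_nonneg hp (mul_self_nonneg ε)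

/-- Dually subadditive distortion risk measures are subadditive on counter-monotonic pairs. -/
lemma MemH.distortion_add_le_of_counterMonotone (hh : MemH h) (hd : DuallySubadditive h)
    (hX : MemLinf X) (hY : MemLinf Y) (hXY : CounterMonotone P X Y) :
    distortion P h (fun ω => X ω + Y ω) ≤ distortion P h X + distortion P h Y := by
  refine hh.distortion_add_le_of_discretizations hX.isBdd hY.isBdd fun ε hε => ?_
  obtain ⟨K, hK⟩ := exists_abs_floor_le hX.isBdd hε
  obtain ⟨K', hK'⟩ := exists_abs_floor_le hY.isBdd hε
  refine hh.distortion_add_le_of_discrete_counterMonotone hd (hX.measurable_floor_div ε)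
    (hY.measurable_floor_div ε) (fun ω => (hK ω).trans (le_max_left K K'))
    (fun ω => (hK' ω).trans (le_max_right K K')) hε.le (hXY.mono fun p hp => ?_)
  refine floor_mul_floor_nonpos ?_
  rw [div_sub_div_mul_div_sub_div]
  exact div_nonpos_of_nonpos_of_nonneg hp (mul_self_nonneg ε)

end Pair

section Sum

variable {P : Measure Ω} [IsProbabilityMeasure P] {h : ℝ → ℝ} {n : ℕ} {Xs : Fin n → Ω → ℝ}

lemma memLinf_sum (hXs : ∀ i, MemLinf (Xs i)) (s : Finset (Fin n)) :
    MemLinf fun ω => ∑ i ∈ s, Xs i ω := by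
  choose hm M hM using hXs
  exact ⟨Finset.measurable_fun_sum s fun i _ => hm i, ∑ i ∈ s, M i, fun ω =>
    (Finset.abs_sum_le_sum_abs _ _).trans (Finset.sum_le_sum fun i _ => hM i ω)⟩

lemma MemH.distortion_sum_le_of_pair (hh : MemH h)
    (hpair : ∀ i, ∀ s : Finset (Fin n), i ∉ s →
      distortion P h (fun ω => Xs i ω + ∑ j ∈ s, Xs j ω) ≤
        distortion P h (Xs i) + distortion P h (fun ω => ∑ j ∈ s, Xs j ω)) :
    distortion P h (fun ω => ∑ i, Xs i ω) ≤ ∑ i, distortion P h (Xs i) := by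
  suffices H : ∀ s : Finset (Fin n),
      distortion P h (fun ω => ∑ i ∈ s, Xs i ω) ≤ ∑ i ∈ s, distortion P h (Xs i) from H _
  intro s
  induction s using Finset.induction_on with
  | empty => simp [hh.distortion_const]
  | insert i s his ih =>
    simp only [Finset.sum_insert his]
    linarith [hpair i s his]

lemma MemH.distortion_sum_le_of_pairwiseCom (hh : MemH h) (hXs : ∀ i, MemLinf (Xs i))
    (hcom : PairwiseCom P Xs) :
    distortion P h (fun ω => ∑ i, Xs i ω) ≤ ∑ i, distortion P h (Xs i) := by
  refine hh.distortion_sum_le_of_pair fun i s his =>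
    hh.distortion_add_le_of_comonotone (hXs i) (memLinf_sum hXs s) ?_
  have : ∀ᵐ p ∂(P.prod P), ∀ j ∈ s, 0 ≤ (Xs i p.1 - Xs i p.2) * (Xs j p.1 - Xs j p.2) :=
    (Finset.eventually_all s).2 fun j hj => hcom i j fun hij => his (hij ▸ hj)
  filter_upwards [this] with p hp
  rw [← Finset.sum_sub_distrib, Finset.mul_sum]
  exact Finset.sum_nonneg hp

lemma MemH.distortion_sum_le_of_pairwiseCtr (hh : MemH h) (hd : DuallySubadditive h)
    (hXs : ∀ i, MemLinf (Xs i)) (hctr : PairwiseCtr P Xs) :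
    distortion P h (fun ω => ∑ i, Xs i ω) ≤ ∑ i, distortion P h (Xs i) := by
  refine hh.distortion_sum_le_of_pair fun i s his =>
    hh.distortion_add_le_of_counterMonotone hd (hXs i) (memLinf_sum hXs s) ?_
  have : ∀ᵐ p ∂(P.prod P), ∀ j ∈ s, (Xs i p.1 - Xs i p.2) * (Xs j p.1 - Xs j p.2) ≤ 0 :=
    (Finset.eventually_all s).2 fun j hj => hctr i j fun hij => his (hij ▸ hj)
  filter_upwards [this] with p hp
  rw [← Finset.sum_sub_distrib, Finset.mul_sum]
  exact Finset.sum_nonpos hp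

/-- The allocation giving everything to agent `j`. -/
def soleAlloc (j : Fin n) (X : Ω → ℝ) (i : Fin n) : Ω → ℝ :=
  if i = j then X else fun _ => 0

lemma isAlloc_soleAlloc (j : Fin n) {X : Ω → ℝ} (hX : MemLinf X) :
    IsAlloc P X (soleAlloc j X) := by
  refine ⟨fun i => ?_, .of_forall fun ω => ?_⟩
  · unfold soleAlloc
    split_ifs
    · exact hX
    · exact ⟨measurable_const, isBdd_const 0⟩
  · rw [Finset.sum_eq_single j (fun i _ hij => by simp [soleAlloc, hij]) (by simp)]
    simp [soleAlloc]

lemma soleAlloc_sub_mul_sub (j : Fin n) (X : Ω → ℝ) {i k : Fin n} (hik : i ≠ k) (a b : Ω) :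
    (soleAlloc j X i a - soleAlloc j X i b) * (soleAlloc j X k a - soleAlloc j X k b) = 0 := by
  by_cases hi : i = j
  · have hk : k ≠ j := fun hk => hik (hi.trans hk.symm)
    simp [soleAlloc, hk]
  · simp [soleAlloc, hi]

lemma sum_distortion_soleAlloc {h : Fin n → ℝ → ℝ} (hH : ∀ i, MemH (h i)) (j : Fin n)
    (X : Ω → ℝ) : ∑ i, distortion P (h i) (soleAlloc j X i) = distortion P (h j) X := by
  rw [Finset.sum_eq_single j (fun i _ hij => ?_) (by simp)]
  · simp [soleAlloc]
  · simp [soleAlloc, hij, (hH i).distortion_const]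

end Sum

/-- Theorem 1 (ii). If `h = min_i h_i` is dually subadditive and `h_j = h`
for some `j`, then `⊟ ρ_{h_i}(X) = ⊞ ρ_{h_i}(X) = ρ_h(X) ≥ □ ρ_{h_i}(X)` for every `X ∈ L^∞`. -/
theorem thm1_ii
    (P : Measure Ω) [IsProbabilityMeasure P] (hP : Atomless P)
    {n : ℕ} (hn : 0 < n)
    (h : Fin n → ℝ → ℝ) (hH : ∀ i, MemH (h i))
    (hmin : ℝ → ℝ) (hmin_def : ∀ x, hmin x = ⨅ i, h i x)
    (hdual : DuallySubadditive hmin)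
    (hj : ∃ j, h j = hmin)
    (X : Ω → ℝ) (hX : MemLinf X) :
    ctrInfConv P h X = ((distortion P hmin X : ℝ) : EReal) ∧
    comInfConv P h X = ((distortion P hmin X : ℝ) : EReal) ∧
    infConv P h X ≤ ((distortion P hmin X : ℝ) : EReal) := by
  obtain ⟨j, hj⟩ := hj
  have hh : MemH hmin := hj ▸ hH j
  have hle (i : Fin n) (x : ℝ) : hmin x ≤ h i x := by
    rw [hmin_def]
    exact ciInf_le (finite_range _).bddBelow i
  have hsum {Xs : Fin n → Ω → ℝ} (hXs : IsAlloc P X Xs)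
      (hsub : distortion P hmin (fun ω => ∑ i, Xs i ω) ≤ ∑ i, distortion P hmin (Xs i)) :
      distortion P hmin X ≤ ∑ i, distortion P (h i) (Xs i) := by
    rw [← distortion_congr_ae hXs.2]
    exact hsub.trans (Finset.sum_le_sum fun i _ =>
      hh.distortion_mono_distortion (hH i) (hle i) (hXs.1 i).isBdd)
  have hsole : ((distortion P hmin X : ℝ) : EReal)
      = ((∑ i, distortion P (h i) (soleAlloc j X i) : ℝ) : EReal) := by
    rw [sum_distortion_soleAlloc hH, hj]
  refine ⟨le_antisymm (sInf_le ?_) (le_sInf ?_), le_antisymm (sInf_le ?_) (le_sInf ?_),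
    sInf_le ⟨_, isAlloc_soleAlloc j hX, hsole⟩⟩
  · exact ⟨_, isAlloc_soleAlloc j hX, fun i k hik =>
      .of_forall fun p => (soleAlloc_sub_mul_sub j X hik p.1 p.2).le, hsole⟩
  · rintro _ ⟨Xs, hXs, hctr, rfl⟩
    exact EReal.coe_le_coe_iff.2 (hsum hXs (hh.distortion_sum_le_of_pairwiseCtr hdual hXs.1 hctr))
  · exact ⟨_, isAlloc_soleAlloc j hX, fun i k hik =>
      .of_forall fun p => (soleAlloc_sub_mul_sub j X hik p.1 p.2).ge, hsole⟩
  · rintro _ ⟨Xs, hXs, hcom, rfl⟩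
    exact EReal.coe_le_coe_iff.2 (hsum hXs (hh.distortion_sum_le_of_pairwiseCom hXs.1 hcom))
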